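/- Let q be a prime power. (a) If q ≥ 5, 0 ≤ t ≤ q, 4 ≤ m ≤ q−1, and 0 ≤ ℓ ≤ m−1, set n = t + (q²−q)/2; then there exist F_q-linear codes D ⊆ C of length n such that dim(C) − dim(D) = m(m−1)/2 + ℓ − 4, the minimum distance of the Euclidean dual D^⊥ equals 4, and the minimum distance of C is at least the designed distance δ. (b) If q = 4 and 1 ≤ t ≤ 4, then there exist F_4-linear codes D ⊆ C of length t + 6 such that dim(C) − dim(D) = 1, the minimum distance of D^⊥ equals 4, and the minimum distance of C is at least δ (computed with m = 3, ℓ = 2). (Equivalently, there exist pure asymmetric quantum CSS codes with parameters [[n, m(m−1)/2 + ℓ − 4, {d_z ≥ δ, d_x = 4}]]_q in case (a) and [[t+6, 1, {d_z ≥ δ, d_x = 4}]]_4 in case (b).) -/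

import Mathlib

/-- The Euclidean dual of a linear code `C ⊆ F^ι`. -/
noncomputable def dualCode {F : Type*} [Field F] {ι : Type*} [Fintype ι]
    (C : Submodule F (ι → F)) : Submodule F (ι → F) where
  carrier := {u | ∀ v ∈ C, ∑ i, u i * v i = 0}
  add_mem' := by
    intro a b ha hb v hv
    have h : ∑ i, (a i + b i) * v i = (∑ i, a i * v i) + ∑ i, b i * v i := by
      rw [← Finset.sum_add_distrib]
      exact Finset.sum_congr rfl fun i _ => add_mul _ _ _
    simp [h, ha v hv, hb v hv]
  zero_mem' := by
    intro v hv
    simp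
  smul_mem' := by
    intro c a ha v hv
    have h : ∑ i, (c * a i) * v i = c * ∑ i, a i * v i := by
      rw [Finset.mul_sum]
      exact Finset.sum_congr rfl fun i _ => mul_assoc _ _ _
    simp [smul_eq_mul, h, ha v hv]

/-- The minimum distance of a linear code: the least Hamming weight of a
nonzero codeword. -/
noncomputable def minDist {F : Type*} [Field F] [DecidableEq F] {ι : Type*} [Fintype ι]
    (C : Submodule F (ι → F)) : ℕ :=
  sInf {w | ∃ v ∈ C, v ≠ 0 ∧ hammingNorm v = w}

open Polynomial in
/-- The quadratic with trace `P.1` and norm `P.2`. -/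
noncomputable def quadP {F : Type*} [Field F] (P : F × F) : F[X] :=
  X ^ 2 - C P.1 * X + C P.2

/-- The points (trace, norm) of the irreducible quadratics. -/
noncomputable def irrP (F : Type*) [Field F] [Fintype F] [DecidableEq F] : Finset (F × F) :=
  Finset.univ.filter fun P => ∀ x : F, x ^ 2 - P.1 * x + P.2 ≠ 0

/-- Evaluation of the bivariate polynomial with coefficients `c` on `I`. -/
noncomputable def bev {F : Type*} [Field F] {R : Type*} [CommRing R] [Algebra F R]
    (I : Finset (Σ _ : ℕ, ℕ)) (c : (Σ _ : ℕ, ℕ) → F) (T N : R) : R :=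
  ∑ i ∈ I, algebraMap F R (c i) * (T ^ (i.1 - i.2) * N ^ i.2)

/-- Exponent set. -/
def expSet (m l : ℕ) : Finset (Σ _ : ℕ, ℕ) :=
  (Finset.range m).sigma fun s => Finset.range (if s = m - 1 then l + 1 else s + 1)

section parta
open Polynomial

variable {F : Type*} [Field F]

lemma expSet_card (m l : ℕ) (hm : 1 ≤ m) : (expSet m l).card = m * (m - 1) / 2 + l + 1 := by
  obtain ⟨k, rfl⟩ : ∃ k, m = k + 1 := ⟨m - 1, by omega⟩
  rw [expSet, Finset.card_sigma, Finset.sum_range_succ]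
  have : ∀ s ∈ Finset.range k, (Finset.range (if s = k + 1 - 1 then l + 1 else s + 1)).card
      = s + 1 := by
    intro s hs
    have := Finset.mem_range.1 hs
    rw [if_neg (by omega)]; simp
  rw [Finset.sum_congr rfl this]
  have h2 := Finset.sum_range_succ' (fun i => i) k
  rw [Finset.sum_range_id] at h2
  simp at h2 ⊢
  omega

lemma mem_expSet {m l : ℕ} (hm : 1 ≤ m) (hl : l ≤ m - 1) {i : Σ _ : ℕ, ℕ} :
    i ∈ expSet m l ↔ (i.2 ≤ i.1 ∧ (i.1 + 2 ≤ m ∨ (i.1 + 1 = m ∧ i.2 ≤ l))) := by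
  rw [expSet, Finset.mem_sigma, Finset.mem_range, Finset.mem_range]
  split_ifs <;> omega

lemma quadP_monic (P : F × F) : (quadP P).Monic := by
  unfold quadP; monicity!

lemma quadP_natDegree (P : F × F) : (quadP P).natDegree = 2 := by
  unfold quadP; compute_degree!

lemma quadP_inj {P P' : F × F} (h : quadP P = quadP P') : P = P' := by
  have h0 := congrArg (fun p => p.coeff 0) h
  have h1 := congrArg (fun p => p.coeff 1) h
  simp [quadP, coeff_X, coeff_C] at h0 h1
  exact Prod.ext h1 h0

variable [Fintype F] [DecidableEq F]

lemma quadP_irr {P : F × F} (hP : P ∈ irrP F) : Irreducible (quadP P) := by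
  rw [(quadP_monic P).irreducible_iff_roots_eq_zero_of_degree_le_three
    (by rw [quadP_natDegree]) (by rw [quadP_natDegree]; norm_num)]
  rw [Multiset.eq_zero_iff_forall_notMem]
  intro x hx
  have := isRoot_of_mem_roots hx
  simp [quadP] at this
  exact (Finset.mem_filter.1 hP).2 x this

lemma quadP_not_dvd {P : F × F} (hP : P ∈ irrP F) :
    ¬ quadP P ∣ (X ^ Fintype.card F - X : F[X]) := by
  intro h
  have hp := (quadP_irr hP).prime
  have hprod : (X ^ Fintype.card F - X : F[X]) = ∏ a : F, (X - C a) := by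
    have hm : (X ^ Fintype.card F - X : F[X]).Monic := by
      apply monic_X_pow_sub
      rw [degree_X]
      exact_mod_cast Fintype.one_lt_card
    have := prod_multiset_X_sub_C_of_monic_of_roots_card_eq hm (by
      rw [FiniteField.roots_X_pow_card_sub_X,
        FiniteField.X_pow_card_sub_X_natDegree_eq F Fintype.one_lt_card]; simp)
    rw [FiniteField.roots_X_pow_card_sub_X] at this
    exact this.symm
  rw [hprod, hp.dvd_finsetProd_iff] at h
  obtain ⟨a, -, ha⟩ := h
  have := natDegree_le_of_dvd ha (X_sub_C_ne_zero a)
  rw [quadP_natDegree, natDegree_X_sub_C] at this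
  omega

lemma quadP_dvd_trace {P : F × F} (hP : P ∈ irrP F) :
    quadP P ∣ (X ^ Fintype.card F + X - C P.1 : F[X]) := by
  have h1 : quadP P ∣ (X ^ Fintype.card F - X : F[X]) * (X ^ Fintype.card F + X - C P.1) := by
    have h2 : (X ^ Fintype.card F - X : F[X]) * (X ^ Fintype.card F + X - C P.1)
      = quadP P ^ Fintype.card F - quadP P := by
      rw [← FiniteField.expand_card (quadP P)]
      simp only [quadP, map_add, map_sub, map_mul, map_pow, expand_X, expand_C]
      ring
    rw [h2]
    exact dvd_sub (dvd_pow_self _ Fintype.card_ne_zero) dvd_rfl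
  exact ((quadP_irr hP).prime.dvd_or_dvd h1).resolve_left (quadP_not_dvd hP)

lemma quadP_dvd_norm {P : F × F} (hP : P ∈ irrP F) :
    quadP P ∣ (X ^ (Fintype.card F + 1) - C P.2 : F[X]) := by
  have : (X ^ (Fintype.card F + 1) - C P.2 : F[X])
    = X * (X ^ Fintype.card F + X - C P.1) - quadP P := by
    rw [quadP]; ring
  rw [this]
  exact dvd_sub (Dvd.dvd.mul_left (quadP_dvd_trace hP) _) dvd_rfl

lemma bev_congr {R : Type*} [CommRing R] [Algebra F R] (I : Finset (Σ _ : ℕ, ℕ))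
    (c : (Σ _ : ℕ, ℕ) → F) {T N T' N' d : R} (h1 : d ∣ T - T') (h2 : d ∣ N - N') :
    d ∣ bev I c T N - bev I c T' N' := by
  rw [← Ideal.mem_span_singleton, ← Ideal.Quotient.eq] at *
  simp only [bev, map_sum, map_mul, map_pow, h1, h2]

lemma bev_map {R S : Type*} [CommRing R] [Algebra F R] [CommRing S] [Algebra F S]
    (φ : R →ₐ[F] S) (I : Finset (Σ _ : ℕ, ℕ))
    (c : (Σ _ : ℕ, ℕ) → F) (T N : R) :
    φ (bev I c T N) = bev I c (φ T) (φ N) := by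
  simp only [bev, map_sum, map_mul, map_pow, AlgHom.commutes]

/-- The one-variable polynomial. -/
noncomputable def phi (I : Finset (Σ _ : ℕ, ℕ)) (c : (Σ _ : ℕ, ℕ) → F) : F[X] :=
  bev I c (X ^ Fintype.card F + X) (X ^ (Fintype.card F + 1))

lemma quadP_dvd_phi (I : Finset (Σ _ : ℕ, ℕ)) (c : (Σ _ : ℕ, ℕ) → F) {P : F × F}
    (hP : P ∈ irrP F) (h0 : bev I c P.1 P.2 = 0) : quadP P ∣ phi I c := by
  have h := bev_congr I c (quadP_dvd_trace hP) (quadP_dvd_norm hP)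
  have h3 := bev_map (Algebra.ofId F F[X]) I c P.1 P.2
  rw [h0, map_zero] at h3
  have h4 : ∀ a : F, Algebra.ofId F F[X] a = C a := fun a => rfl
  rw [h4, h4] at h3
  rw [← h3, sub_zero] at h
  exact h

lemma phi_eval (I : Finset (Σ _ : ℕ, ℕ)) (c : (Σ _ : ℕ, ℕ) → F) (a : F) :
    (phi I c).eval a = bev I c (2 * a) (a ^ 2) := by
  have := bev_map (aeval (R := F) a) I c (X ^ Fintype.card F + X) (X ^ (Fintype.card F + 1))
  rw [phi, ← coe_aeval_eq_eval]
  change (aeval a) _ = _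
  rw [this]
  simp [FiniteField.pow_card, pow_succ]
  congr 1
  ring

lemma mono_monic (a b : ℕ) :
    ((X ^ Fintype.card F + X : F[X]) ^ a * (X ^ (Fintype.card F + 1)) ^ b).Monic ∧
    ((X ^ Fintype.card F + X : F[X]) ^ a * (X ^ (Fintype.card F + 1)) ^ b).natDegree
      = Fintype.card F * a + (Fintype.card F + 1) * b := by
  have hq : 1 < Fintype.card F := Fintype.one_lt_card
  have h1 : (X ^ Fintype.card F + X : F[X]).Monic := by
    apply monic_X_pow_add
    rw [degree_X]
    exact_mod_cast hq
  have h2 : (X ^ (Fintype.card F + 1) : F[X]).Monic := monic_X_pow _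
  have h3 : (X ^ Fintype.card F + X : F[X]).natDegree = Fintype.card F := by
    rw [natDegree_add_eq_left_of_natDegree_lt] <;> simp [hq]
  refine ⟨(h1.pow a).mul (h2.pow b), ?_⟩
  rw [(h1.pow a).natDegree_mul (h2.pow b), h1.natDegree_pow, h2.natDegree_pow, h3, natDegree_X_pow]
  ring

lemma term_degree (i : Σ _ : ℕ, ℕ) (hi : i.2 ≤ i.1) {c : F} (hc : c ≠ 0) :
    (algebraMap F F[X] c * ((X ^ Fintype.card F + X : F[X]) ^ (i.1 - i.2)
      * (X ^ (Fintype.card F + 1)) ^ i.2)).degree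
      = ((Fintype.card F * i.1 + i.2 : ℕ) : WithBot ℕ) := by
  have h := mono_monic (F := F) (i.1 - i.2) i.2
  rw [algebraMap_eq, degree_C_mul hc, degree_eq_natDegree h.1.ne_zero, h.2]
  obtain ⟨k, hk⟩ := Nat.exists_eq_add_of_le hi
  rw [hk]
  congr 1
  simp
  ring

lemma phi_degree_le (I : Finset (Σ _ : ℕ, ℕ)) (c : (Σ _ : ℕ, ℕ) → F) (d : ℕ)
    (hI : ∀ i ∈ I, i.2 ≤ i.1 ∧ Fintype.card F * i.1 + i.2 ≤ d) : (phi I c).natDegree ≤ d := by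
  rw [natDegree_le_iff_degree_le]
  unfold phi bev
  refine (degree_sum_le _ _).trans (Finset.sup_le fun i hi => ?_)
  by_cases hc : c i = 0
  · simp [hc]
  · rw [term_degree i (hI i hi).1 hc]
    exact_mod_cast (hI i hi).2

lemma phi_ne_zero (I : Finset (Σ _ : ℕ, ℕ)) (c : (Σ _ : ℕ, ℕ) → F)
    (hI : ∀ i ∈ I, i.2 ≤ i.1 ∧ i.2 < Fintype.card F) (h : phi I c = 0) : ∀ i ∈ I, c i = 0 := by
  intro i hi
  by_contra hc
  unfold phi bev at h
  have h2 := degree_sum_eq_of_disjoint (fun i : (Σ _ : ℕ, ℕ) => algebraMap F F[X] (c i) *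
    ((X ^ Fintype.card F + X : F[X]) ^ (i.1 - i.2) * (X ^ (Fintype.card F + 1)) ^ i.2)) I (by
      rintro x ⟨hx, hx0⟩ y ⟨hy, hy0⟩ hxy he
      have hcx : c x ≠ 0 := by intro h; simp [h] at hx0
      have hcy : c y ≠ 0 := by intro h; simp [h] at hy0
      simp only [Function.comp] at he
      rw [term_degree x (hI x hx).1 hcx, term_degree y (hI y hy).1 hcy] at he
      have he' : Fintype.card F * x.1 + x.2 = Fintype.card F * y.1 + y.2 := by exact_mod_cast he
      have hx2 := (hI x hx).2
      have hy2 := (hI y hy).2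
      have e2 : x.2 = y.2 := by
        have := congrArg (· % Fintype.card F) he'
        simpa [Nat.mul_add_mod, Nat.mod_eq_of_lt hx2, Nat.mod_eq_of_lt hy2] using this
      have e1 : x.1 = y.1 := by
        rw [e2] at he'
        exact Nat.eq_of_mul_eq_mul_left Fintype.card_pos (Nat.add_right_cancel he')
      apply hxy
      cases x; cases y; simp_all)
  rw [h, degree_zero] at h2
  have h3 := Finset.le_sup (f := fun i : (Σ _ : ℕ, ℕ) => (algebraMap F F[X] (c i) *
    ((X ^ Fintype.card F + X : F[X]) ^ (i.1 - i.2) *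
      (X ^ (Fintype.card F + 1)) ^ i.2)).degree) hi
  rw [← h2] at h3
  rw [term_degree i (hI i hi).1 hc] at h3
  exact WithBot.natCast_ne_bot _ (le_bot_iff.1 h3)

/-- Main root count. -/
lemma count_bound (I : Finset (Σ _ : ℕ, ℕ)) (c : (Σ _ : ℕ, ℕ) → F) (hne : phi I c ≠ 0)
    (W : F[X]) (hW : W ∣ phi I c) (hW2 : W ∣ (X ^ Fintype.card F - X) ^ 2) :
    2 * ((irrP F).filter fun P => bev I c P.1 P.2 = 0).card + W.natDegree
      ≤ (phi I c).natDegree := by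
  set Z := (irrP F).filter fun P => bev I c P.1 P.2 = 0 with hZ
  have hZm : ∀ P ∈ Z, P ∈ irrP F ∧ bev I c P.1 P.2 = 0 := fun P hP => Finset.mem_filter.1 hP
  have h1 : ∏ P ∈ Z, quadP P ∣ phi I c := by
    apply Finset.prod_dvd_of_coprime
    · intro P hP P' hP' hPP
      rw [Function.onFun, (quadP_irr (hZm P hP).1).coprime_iff_not_dvd]
      intro hd
      apply hPP
      apply quadP_inj
      refine (eq_of_monic_of_dvd_of_natDegree_le (quadP_monic P) (quadP_monic P') hd ?_).symm
      rw [quadP_natDegree, quadP_natDegree]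
    · intro P hP
      exact quadP_dvd_phi I c (hZm P hP).1 (hZm P hP).2
  have h2 : IsCoprime (∏ P ∈ Z, quadP P) W := by
    apply IsCoprime.of_isCoprime_of_dvd_right _ hW2
    apply IsCoprime.pow_right
    apply IsCoprime.prod_left
    intro P hP
    rw [(quadP_irr (hZm P hP).1).coprime_iff_not_dvd]
    exact quadP_not_dvd (hZm P hP).1
  have h3 := h2.mul_dvd h1 hW
  have h4 := natDegree_le_of_dvd h3 hne
  have hm : (∏ P ∈ Z, quadP P).Monic := monic_prod_of_monic _ _ fun P _ => quadP_monic P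
  have hW0 : W ≠ 0 := ne_zero_of_dvd_ne_zero hne hW
  rw [hm.natDegree_mul' hW0, natDegree_prod_of_monic _ _ fun P _ => quadP_monic P] at h4
  simp only [quadP_natDegree, Finset.sum_const, smul_eq_mul] at h4
  omega

lemma count_bound_roots (I : Finset (Σ _ : ℕ, ℕ)) (c : (Σ _ : ℕ, ℕ) → F) (hne : phi I c ≠ 0)
    (S : Finset F) :
    2 * ((irrP F).filter fun P => bev I c P.1 P.2 = 0).card
      + (S.filter fun a => bev I c (2 * a) (a ^ 2) = 0).card ≤ (phi I c).natDegree := by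
  have hco : ((S.filter fun a => bev I c (2 * a) (a ^ 2) = 0 : Finset F) : Set F).Pairwise
      (Function.onFun IsCoprime fun a => (X - C a : F[X])) := by
    intro a _ b _ hab
    exact isCoprime_X_sub_C_of_isUnit_sub (sub_ne_zero.2 hab).isUnit
  have := count_bound I c hne (∏ a ∈ S.filter fun a => bev I c (2 * a) (a ^ 2) = 0, (X - C a)) (by
    apply Finset.prod_dvd_of_coprime hco
    intro a ha
    rw [dvd_iff_isRoot, IsRoot, phi_eval]
    exact (Finset.mem_filter.1 ha).2) (by
    apply Finset.prod_dvd_of_coprime hco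
    intro a ha
    rw [dvd_iff_isRoot, IsRoot]
    simp [FiniteField.pow_card])
  rw [natDegree_prod_of_monic _ _ fun a _ => monic_X_sub_C a] at this
  simpa using this

lemma irrP_card : (irrP F).card = (Fintype.card F ^ 2 - Fintype.card F) / 2 := by
  classical
  let f : Sym2 F → F × F := Sym2.lift ⟨fun x y => (x + y, x * y), fun x y => by
    simp only [add_comm, mul_comm]⟩
  have hf : Function.Injective f := by
    intro a b
    induction a with | _ x y
    induction b with | _ z w
    intro h
    simp only [f, Sym2.lift_mk, Prod.mk.injEq] at h
    obtain ⟨h1, h2⟩ := h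
    have h3 : (x - z) * (x - w) = 0 := by linear_combination x * h1 - h2
    rw [Sym2.eq_iff]
    rcases mul_eq_zero.1 h3 with h | h
    · left
      have := sub_eq_zero.1 h
      subst this
      exact ⟨rfl, add_left_cancel h1⟩
    · right
      have := sub_eq_zero.1 h
      subst this
      exact ⟨rfl, by linear_combination h1⟩
  have hc : (irrP F)ᶜ = Finset.univ.image f := by
    ext P
    simp only [irrP, Finset.mem_compl, Finset.mem_filter, Finset.mem_univ, true_and, not_forall,
      not_not, Finset.mem_image]
    constructor
    · rintro ⟨x, hx⟩
      refine ⟨s(x, P.1 - x), ?_⟩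
      simp only [f, Sym2.lift_mk]
      ext
      · simp
      · simp only; linear_combination -hx
    · rintro ⟨a, ha⟩
      induction a with | _ x y
      simp only [f, Sym2.lift_mk] at ha
      refine ⟨x, ?_⟩
      rw [← ha]
      ring
  have h1 := Finset.card_compl (irrP F)
  rw [hc, Finset.card_image_of_injective _ hf, Finset.card_univ, Sym2.card, Fintype.card_prod,
    Nat.choose_two_right] at h1
  have h2 : (irrP F).card ≤ Fintype.card F * Fintype.card F := by
    rw [← Fintype.card_prod]; exact Finset.card_le_univ _
  have h3 := Nat.even_mul_succ_self (Fintype.card F)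
  obtain ⟨k, hk⟩ := h3
  have h4 : (Fintype.card F + 1) * (Fintype.card F + 1 - 1) = k + k := by
    rw [← hk]; simp; ring
  rw [h4] at h1
  rw [pow_two]
  rw [Nat.mul_succ] at hk
  have : 0 < Fintype.card F := Fintype.card_pos
  omega

end parta
section partb
open Polynomial
variable {F : Type*} [Field F] [Fintype F] [DecidableEq F]

lemma bev_degree_le (I : Finset (Σ _ : ℕ, ℕ)) (c : (Σ _ : ℕ, ℕ) → F) (T N : F[X]) (d : ℕ)
    (h : ∀ i ∈ I, (T ^ (i.1 - i.2) * N ^ i.2).natDegree ≤ d) :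
    (bev I c T N).natDegree ≤ d := by
  unfold bev
  apply natDegree_sum_le_of_forall_le
  intro i hi
  rw [algebraMap_eq]
  exact (natDegree_C_mul_le _ _).trans (h i hi)

lemma bev_eval (I : Finset (Σ _ : ℕ, ℕ)) (c : (Σ _ : ℕ, ℕ) → F) (T N : F[X]) (a : F) :
    (bev I c T N).eval a = bev I c (T.eval a) (N.eval a) := by
  have := bev_map (aeval (R := F) a) I c T N
  simpa using this

lemma zero_bound_odd {m l t : ℕ} (hm : 3 ≤ m) (hl : l ≤ m - 1)
    (h2 : (2 : F) ≠ 0) (S : Finset F) (hS : S.card = t) (ht : t ≤ Fintype.card F)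
    (c : (Σ _ : ℕ, ℕ) → F) (hne : phi (expSet m l) c ≠ 0) :
    2 * ((((irrP F).filter fun P => bev (expSet m l) c P.1 P.2 = 0).card : ℤ) +
      (S.filter fun a => bev (expSet m l) c (2 * a) (a ^ 2) = 0).card) ≤
      (phi (expSet m l) c).natDegree
        + min (max (2 * ((m : ℤ) - 2)) ((m : ℤ) + l - 1)) (t : ℤ) := by
  have hb := count_bound_roots (expSet m l) c hne S
  have hbt : (S.filter fun a => bev (expSet m l) c (2 * a) (a ^ 2) = 0).card ≤ t :=
    (Finset.card_filter_le _ _).trans hS.le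
  by_cases hp : bev (expSet m l) c (C 2 * X : F[X]) (X ^ 2) = 0
  · have h3 : (X ^ Fintype.card F - X : F[X]) ^ 2 ∣ phi (expSet m l) c := by
      have e := bev_map (aeval (R := F) (C (1 / 2) * (X ^ Fintype.card F + X) : F[X]))
        (expSet m l) c (C 2 * X) (X ^ 2)
      rw [hp, map_zero] at e
      have h22 : (C 2 * C (1 / 2) : F[X]) = 1 := by
        rw [← C_mul, mul_one_div_cancel h2, C_1]
      have := bev_congr (expSet m l) c (d := (X ^ Fintype.card F - X : F[X]) ^ 2)
        (T := (X ^ Fintype.card F + X : F[X])) (N := X ^ (Fintype.card F + 1))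
        (T' := aeval (R := F) (C (1 / 2) * (X ^ Fintype.card F + X) : F[X]) (C 2 * X))
        (N' := aeval (R := F) (C (1 / 2) * (X ^ Fintype.card F + X) : F[X]) (X ^ 2))
        (by
          have : (X ^ Fintype.card F + X : F[X]) - aeval (R := F)
            (C (1 / 2) * (X ^ Fintype.card F + X) : F[X]) (C 2 * X) = 0 := by
            rw [map_mul, aeval_C, aeval_X, algebraMap_eq, ← mul_assoc, h22]; ring
          rw [this]; exact dvd_zero _)
        (by
          refine ⟨- C (1 / 2) ^ 2, ?_⟩
          rw [map_pow, aeval_X]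
          have h4 : (1 : F[X]) = (C 2) ^ 2 * C (1 / 2) ^ 2 := by rw [← mul_pow, h22, one_pow]
          have h5 : (C 2 : F[X]) = 2 := rfl
          rw [h5] at h4
          calc _ = (1 : F[X]) * X ^ (Fintype.card F + 1)
                - (C (1 / 2) * (X ^ Fintype.card F + X)) ^ 2 := by ring
            _ = _ := by rw [h4]; ring)
      rw [← e, sub_zero] at this
      exact this
    have h4 := count_bound _ c hne _ h3 dvd_rfl
    rw [natDegree_pow, FiniteField.X_pow_card_sub_X_natDegree_eq F Fintype.one_lt_card] at h4
    omega
  · have h3 : (S.filter fun a => bev (expSet m l) c (2 * a) (a ^ 2) = 0).card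
        ≤ max (2 * (m - 2)) (m - 1 + l) := by
      refine le_trans (card_le_degree_of_subset_roots
        (p := bev (expSet m l) c (C 2 * X : F[X]) (X ^ 2)) ?_) (bev_degree_le _ _ _ _ _ ?_)
      · intro a ha
        rw [mem_roots hp, IsRoot, bev_eval]
        simpa using (Finset.mem_filter.1 ha).2
      · intro i hi
        rw [mem_expSet (by omega) hl] at hi
        have e1 : (C 2 * X : F[X]).natDegree ≤ 1 :=
          (natDegree_C_mul_le _ _).trans natDegree_X_le
        have e2 : ((C 2 * X : F[X]) ^ (i.1 - i.2) * (X ^ 2) ^ i.2).natDegree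
            ≤ (i.1 - i.2) * 1 + i.2 * 2 := by
          refine natDegree_mul_le.trans (add_le_add ?_ ?_)
          · exact natDegree_pow_le.trans (Nat.mul_le_mul_left _ e1)
          · exact natDegree_pow_le.trans (by rw [natDegree_X_pow])
        omega
    omega

lemma zero_bound_even {m l t : ℕ} (hm : 3 ≤ m) (hl : l ≤ m - 1)
    (h2 : (2 : F) = 0) (S : Finset F) (hS : S.card = t)
    (c : (Σ _ : ℕ, ℕ) → F) (hne : phi (expSet m l) c ≠ 0) (M : ℕ)
    (hM : M = if l ≤ m - 2 then m - 2 else m - 1) :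
    2 * ((((irrP F).filter fun P => bev (expSet m l) c P.1 P.2 = 0).card : ℤ) +
      (S.filter fun a => bev (expSet m l) c (2 * a) (a ^ 2) = 0).card) ≤
      (phi (expSet m l) c).natDegree
        + max (min (M : ℤ) (t : ℤ)) (2 * (t : ℤ) - Fintype.card F) := by
  have hb := count_bound_roots (expSet m l) c hne S
  have hbt : (S.filter fun a => bev (expSet m l) c (2 * a) (a ^ 2) = 0).card ≤ t :=
    (Finset.card_filter_le _ _).trans hS.le
  by_cases hp : bev (expSet m l) c (0 : F[X]) X = 0
  · have h3 : (X ^ Fintype.card F - X : F[X]) ∣ phi (expSet m l) c := by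
      have e := bev_map (aeval (R := F) (X ^ (Fintype.card F + 1) : F[X]))
        (expSet m l) c 0 X
      rw [hp, map_zero, aeval_X] at e
      have := bev_congr (expSet m l) c (d := (X ^ Fintype.card F - X : F[X]))
        (T := (X ^ Fintype.card F + X : F[X])) (N := X ^ (Fintype.card F + 1))
        (T' := 0) (N' := X ^ (Fintype.card F + 1))
        (by
          have h5 : (2 : F[X]) = 0 := by
            have : (C 2 : F[X]) = 2 := rfl
            rw [← this, h2, C_0]
          have : (X ^ Fintype.card F + X : F[X]) - 0 = X ^ Fintype.card F - X := by
            linear_combination X * h5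
          rw [this]) (by rw [sub_self]; exact dvd_zero _)
      rw [← e, sub_zero] at this
      exact this
    have h4 := count_bound _ c hne _ h3 (dvd_pow_self _ two_ne_zero)
    rw [FiniteField.X_pow_card_sub_X_natDegree_eq F Fintype.one_lt_card] at h4
    omega
  · have h3 : (S.filter fun a => bev (expSet m l) c (2 * a) (a ^ 2) = 0).card ≤ M := by
      have hinj : Function.Injective fun a : F => a ^ 2 := by
        intro a b hab
        have h6 : (a - b) ^ 2 = 0 := by
          simp only at hab
          linear_combination hab + (b ^ 2 - a * b) * h2
        exact sub_eq_zero.1 (pow_eq_zero_iff (two_ne_zero) |>.1 h6)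
      rw [← Finset.card_image_of_injective _ hinj]
      refine le_trans (card_le_degree_of_subset_roots
        (p := bev (expSet m l) c (0 : F[X]) X) ?_) (bev_degree_le _ _ _ _ _ ?_)
      · intro a ha
        obtain ⟨b, hb, rfl⟩ := Finset.mem_image.1 ha
        rw [mem_roots hp, IsRoot, bev_eval]
        simpa [h2] using (Finset.mem_filter.1 hb).2
      · intro i hi
        rw [mem_expSet (by omega) hl] at hi
        by_cases h7 : i.1 - i.2 = 0
        · rw [h7, pow_zero, one_mul, natDegree_X_pow]
          rw [hM]
          split_ifs <;> omega
        · rw [zero_pow h7, zero_mul, natDegree_zero]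
          omega
    omega

/-- Monomial codewords. -/
def evm {n : ℕ} (pt : Fin n → F × F) (i : Σ _ : ℕ, ℕ) : Fin n → F :=
  fun k => (pt k).1 ^ (i.1 - i.2) * (pt k).2 ^ i.2

/-- The monomial code. -/
def mcode {n : ℕ} (pt : Fin n → F × F) (I : Finset (Σ _ : ℕ, ℕ)) : Submodule F (Fin n → F) :=
  Submodule.span F (evm pt '' (I : Set (Σ _ : ℕ, ℕ)))

lemma sum_evm {n : ℕ} (pt : Fin n → F × F) (I : Finset (Σ _ : ℕ, ℕ)) (c : (Σ _ : ℕ, ℕ) → F)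
    (k : Fin n) : (∑ i ∈ I, c i • evm pt i) k = bev I c (pt k).1 (pt k).2 := by
  simp [bev, evm]

lemma mem_mcode {n : ℕ} {pt : Fin n → F × F} {I : Finset (Σ _ : ℕ, ℕ)} {v : Fin n → F}
    (hv : v ∈ mcode pt I) : ∃ c : (Σ _ : ℕ, ℕ) → F, ∀ k, v k = bev I c (pt k).1 (pt k).2 := by
  rw [mcode, Submodule.mem_span_image_finset_iff_exists_fun'] at hv
  obtain ⟨c, hc⟩ := hv
  exact ⟨c, fun k => by rw [← hc, sum_evm]⟩

lemma finrank_mcode {n : ℕ} {pt : Fin n → F × F} {I : Finset (Σ _ : ℕ, ℕ)}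
    (h : LinearIndepOn F (evm pt) (I : Set (Σ _ : ℕ, ℕ))) :
    Module.finrank F (mcode pt I) = I.card := by
  have := finrank_span_eq_card (R := F) h
  rw [mcode, Set.image_eq_range]
  simpa using this

/-- The five exponents. -/
def expD : Finset (Σ _ : ℕ, ℕ) := {⟨0, 0⟩, ⟨1, 0⟩, ⟨2, 0⟩, ⟨1, 1⟩, ⟨2, 2⟩}

lemma bev_expD (T N : F) (c : (Σ _ : ℕ, ℕ) → F) : bev expD c T N =
    c ⟨0, 0⟩ + c ⟨1, 0⟩ * T + c ⟨2, 0⟩ * T ^ 2 + c ⟨1, 1⟩ * N + c ⟨2, 2⟩ * N ^ 2 := by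
  simp [bev, expD]
  ring

lemma quad_mem {n : ℕ} (pt : Fin n → F × F) (c0 c1 c2 d1 d2 : F) :
    (fun k => c0 + c1 * (pt k).1 + c2 * (pt k).1 ^ 2 + d1 * (pt k).2 + d2 * (pt k).2 ^ 2)
      ∈ mcode pt expD := by
  have h : ∀ i ∈ expD, evm pt i ∈ mcode pt expD := fun i hi =>
    Submodule.subset_span ⟨i, hi, rfl⟩
  have := add_mem (add_mem (add_mem (add_mem
    (Submodule.smul_mem _ c0 (h ⟨0, 0⟩ (by decide)))
    (Submodule.smul_mem _ c1 (h ⟨1, 0⟩ (by decide))))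
    (Submodule.smul_mem _ c2 (h ⟨2, 0⟩ (by decide))))
    (Submodule.smul_mem _ d1 (h ⟨1, 1⟩ (by decide))))
    (Submodule.smul_mem _ d2 (h ⟨2, 2⟩ (by decide)))
  convert this using 1
  funext k
  simp [evm]

lemma separate (P Q R : F × F) (hQ : P ≠ Q) (hR : P ≠ R) : ∃ c0 c1 c2 d1 d2 : F,
    (c0 + c1 * Q.1 + c2 * Q.1 ^ 2 + d1 * Q.2 + d2 * Q.2 ^ 2 = 0) ∧
    (c0 + c1 * R.1 + c2 * R.1 ^ 2 + d1 * R.2 + d2 * R.2 ^ 2 = 0) ∧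
    (c0 + c1 * P.1 + c2 * P.1 ^ 2 + d1 * P.2 + d2 * P.2 ^ 2 ≠ 0) := by
  obtain ⟨a, b⟩ := P
  obtain ⟨u, v⟩ := Q
  obtain ⟨x, y⟩ := R
  simp only [ne_eq, Prod.mk.injEq, not_and_or] at hQ hR
  by_cases h1 : a ≠ u ∧ a ≠ x
  · refine ⟨u * x, -(u + x), 1, 0, 0, by ring, by ring, ?_⟩
    have := mul_ne_zero (sub_ne_zero.2 h1.1) (sub_ne_zero.2 h1.2)
    intro h; apply this; simp only at h; linear_combination h
  by_cases h2 : b ≠ v ∧ b ≠ y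
  · refine ⟨v * y, 0, 0, -(v + y), 1, by ring, by ring, ?_⟩
    have := mul_ne_zero (sub_ne_zero.2 h2.1) (sub_ne_zero.2 h2.2)
    intro h; apply this; simp only at h; linear_combination h
  have h3 : (a = u ∧ b = y ∧ a ≠ x ∧ b ≠ v) ∨ (a = x ∧ b = v ∧ a ≠ u ∧ b ≠ y) := by tauto
  rcases h3 with ⟨rfl, rfl, h4, h5⟩ | ⟨rfl, rfl, h4, h5⟩
  · refine ⟨-a * (v - b) - b * (x - a) - (x - a) * (v - b), v - b, 0, x - a, 0,
      by ring, by ring, ?_⟩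
    have := mul_ne_zero (sub_ne_zero.2 h4) (sub_ne_zero.2 h5)
    intro h; apply this; simp only at h; linear_combination -h
  · refine ⟨-a * (y - b) - b * (u - a) - (u - a) * (y - b), y - b, 0, u - a, 0,
      by ring, by ring, ?_⟩
    have := mul_ne_zero (sub_ne_zero.2 h4) (sub_ne_zero.2 h5)
    intro h; apply this; simp only at h; linear_combination -h

end partb
section partc
variable {F : Type*} [Field F] [Fintype F] [DecidableEq F]

/-- The evaluation point set. -/
noncomputable def ptSet (S : Finset F) : Finset (F × F) :=
  irrP F ∪ S.image fun a => (2 * a, a ^ 2)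

lemma diag_inj : Function.Injective fun a : F => ((2 * a, a ^ 2) : F × F) := by
  intro a b h
  simp only [Prod.mk.injEq] at h
  have : (a - b) ^ 2 = 0 := by linear_combination h.2 - b * h.1
  exact sub_eq_zero.1 (pow_eq_zero_iff two_ne_zero |>.1 this)

lemma pt_disj (S : Finset F) :
    Disjoint (irrP F) (S.image fun a => ((2 * a, a ^ 2) : F × F)) := by
  rw [Finset.disjoint_left]
  intro P hP hP'
  obtain ⟨a, -, rfl⟩ := Finset.mem_image.1 hP'
  apply (Finset.mem_filter.1 hP).2 a
  ring

lemma ptSet_card (S : Finset F) :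
    (ptSet S).card = S.card + (Fintype.card F ^ 2 - Fintype.card F) / 2 := by
  rw [ptSet, Finset.card_union_of_disjoint (pt_disj S), irrP_card,
    Finset.card_image_of_injective _ diag_inj, add_comm]

lemma minDist_four {n : ℕ} (pt : Fin n → F × F) (hpt : Function.Injective pt)
    (k1 k2 k3 k4 : Fin n) (h12 : k1 ≠ k2) (h13 : k1 ≠ k3) (h14 : k1 ≠ k4) (h23 : k2 ≠ k3)
    (h24 : k2 ≠ k4) (h34 : k3 ≠ k4)
    (r1 : (pt k1).1 - (pt k2).1 - (pt k3).1 + (pt k4).1 = 0)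
    (r2 : (pt k1).2 - (pt k2).2 - (pt k3).2 + (pt k4).2 = 0)
    (r3 : (pt k1).1 ^ 2 - (pt k2).1 ^ 2 - (pt k3).1 ^ 2 + (pt k4).1 ^ 2 = 0)
    (r4 : (pt k1).2 ^ 2 - (pt k2).2 ^ 2 - (pt k3).2 ^ 2 + (pt k4).2 ^ 2 = 0) :
    minDist (dualCode (mcode pt expD)) = 4 := by
  unfold minDist
  apply le_antisymm
  · apply Nat.sInf_le
    refine ⟨Pi.single k1 1 - Pi.single k2 1 - Pi.single k3 1 + Pi.single k4 1, ?_, ?_, ?_⟩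
    · intro v hv
      obtain ⟨c, hc⟩ := mem_mcode hv
      have : ∑ i, (Pi.single k1 1 - Pi.single k2 1 - Pi.single k3 1 + Pi.single k4 1 :
          Fin n → F) i * v i = v k1 - v k2 - v k3 + v k4 := by
        simp [add_mul, sub_mul, Finset.sum_add_distrib, Finset.sum_sub_distrib, Pi.single_apply]
      rw [this, hc, hc, hc, hc, bev_expD, bev_expD, bev_expD, bev_expD]
      linear_combination c ⟨1, 0⟩ * r1 + c ⟨1, 1⟩ * r2 + c ⟨2, 0⟩ * r3 + c ⟨2, 2⟩ * r4
    · intro h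
      have := congrFun h k1
      simp [h12, h13, h14] at this
    · have : (Finset.univ.filter fun i => (Pi.single k1 1 - Pi.single k2 1 - Pi.single k3 1
          + Pi.single k4 1 : Fin n → F) i ≠ 0) = {k1, k2, k3, k4} := by
        ext i
        simp only [Finset.mem_filter, Finset.mem_univ, true_and, Finset.mem_insert,
          Finset.mem_singleton, Pi.add_apply, Pi.sub_apply, Pi.single_apply]
        by_cases e1 : i = k1
        · subst e1; simp [h12, h13, h14]
        by_cases e2 : i = k2
        · subst e2; simp [h12.symm, h23, h24]
        by_cases e3 : i = k3
        · subst e3; simp [h13.symm, h23.symm, h34]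
        by_cases e4 : i = k4
        · subst e4; simp [h14.symm, h24.symm, h34.symm]
        simp [e1, e2, e3, e4]
      rw [hammingNorm, this]
      rw [Finset.card_insert_of_notMem (by simp [*]), Finset.card_insert_of_notMem (by simp [*]),
        Finset.card_insert_of_notMem (by simp [*]), Finset.card_singleton]
  · apply le_csInf
    · by_contra hne
      rw [Set.not_nonempty_iff_eq_empty] at hne
      have hmem : hammingNorm (Pi.single k1 1 - Pi.single k2 1 - Pi.single k3 1
          + Pi.single k4 1 : Fin n → F) ∈ (∅ : Set ℕ) := by
        rw [← hne]
        refine ⟨_, ?_, ?_, rfl⟩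
        · intro v hv
          obtain ⟨c, hc⟩ := mem_mcode hv
          have : ∑ i, (Pi.single k1 1 - Pi.single k2 1 - Pi.single k3 1 + Pi.single k4 1 :
              Fin n → F) i * v i = v k1 - v k2 - v k3 + v k4 := by
            simp [add_mul, sub_mul, Finset.sum_add_distrib, Finset.sum_sub_distrib,
              Pi.single_apply]
          rw [this, hc, hc, hc, hc, bev_expD, bev_expD, bev_expD, bev_expD]
          linear_combination c ⟨1, 0⟩ * r1 + c ⟨1, 1⟩ * r2 + c ⟨2, 0⟩ * r3 + c ⟨2, 2⟩ * r4
        · intro h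
          have := congrFun h k1
          simp [h12, h13, h14] at this
      exact hmem
    · rintro w ⟨u, hu, hu0, rfl⟩
      by_contra hlt
      push Not at hlt
      obtain ⟨i0, hi0⟩ := Function.ne_iff.1 hu0
      simp only [Pi.zero_apply] at hi0
      have hcard : ((Finset.univ.filter fun i => u i ≠ 0).erase i0).card ≤ 2 := by
        rw [Finset.card_erase_of_mem (by simp [hi0])]
        rw [hammingNorm] at hlt
        omega
      have hn2 : 2 ≤ (Finset.univ.erase i0).card := by
        rw [Finset.card_erase_of_mem (Finset.mem_univ _)]
        have : ({k1, k2, k3} : Finset (Fin n)).card = 3 := by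
          rw [Finset.card_insert_of_notMem (by simp [*]),
            Finset.card_insert_of_notMem (by simp [*]), Finset.card_singleton]
        have h3 := Finset.card_le_univ ({k1, k2, k3} : Finset (Fin n))
        rw [this] at h3
        rw [Finset.card_univ]
        omega
      obtain ⟨s, hs1, hs2, hs3⟩ := Finset.exists_subsuperset_card_eq
        (Finset.erase_subset_erase i0 (Finset.subset_univ _)) hcard hn2
      obtain ⟨a, b, hab, rfl⟩ := Finset.card_eq_two.1 hs3
      have ha : a ≠ i0 := Finset.ne_of_mem_erase (hs2 (by simp))
      have hb : b ≠ i0 := Finset.ne_of_mem_erase (hs2 (by simp))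
      obtain ⟨c0, c1, c2, d1, d2, e1, e2, e3⟩ := separate (pt i0) (pt a) (pt b)
        (fun h => ha (hpt h).symm) (fun h => hb (hpt h).symm)
      have hz := hu _ (quad_mem pt c0 c1 c2 d1 d2)
      rw [Finset.sum_eq_single i0] at hz
      · exact (mul_ne_zero hi0 e3) hz
      · intro i _ hi
        by_cases hui : u i = 0
        · rw [hui, zero_mul]
        have : i ∈ ({a, b} : Finset (Fin n)) :=
          hs1 (Finset.mem_erase.2 ⟨hi, by simp [hui]⟩)
        simp only [Finset.mem_insert, Finset.mem_singleton] at this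
        rcases this with rfl | rfl
        · rw [e1, mul_zero]
        · rw [e2, mul_zero]
      · simp

lemma exists_avoid (s : Finset F) (h : s.card < Fintype.card F) : ∃ x, x ∉ s := by
  by_contra hh
  push Not at hh
  rw [Finset.eq_univ_iff_forall.2 hh, Finset.card_univ] at h
  omega

lemma four_points (S : Finset F)
    (hcase : 5 ≤ Fintype.card F ∨ (Fintype.card F = 4 ∧ (0 : F) ∈ S)) :
    ∃ P1 ∈ ptSet S, ∃ P2 ∈ ptSet S, ∃ P3 ∈ ptSet S, ∃ P4 ∈ ptSet S,
      (P1 ≠ P2 ∧ P1 ≠ P3 ∧ P1 ≠ P4 ∧ P2 ≠ P3 ∧ P2 ≠ P4 ∧ P3 ≠ P4) ∧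
      P1.1 - P2.1 - P3.1 + P4.1 = 0 ∧ P1.2 - P2.2 - P3.2 + P4.2 = 0 ∧
      P1.1 ^ 2 - P2.1 ^ 2 - P3.1 ^ 2 + P4.1 ^ 2 = 0 ∧
      P1.2 ^ 2 - P2.2 ^ 2 - P3.2 ^ 2 + P4.2 ^ 2 = 0 := by
  have hmem : ∀ T N : F, (∀ x, x ^ 2 - T * x + N ≠ 0) → (T, N) ∈ ptSet S := by
    intro T N h
    exact Finset.mem_union_left _ (Finset.mem_filter.2 ⟨Finset.mem_univ _, h⟩)
  by_cases h2 : (2 : F) = 0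
  · rcases hcase with h5 | ⟨h4, h0⟩
    · obtain ⟨N, hN⟩ : ∃ N : F, ∀ x, x - x ^ 2 ≠ N := by
        by_contra hh
        push Not at hh
        have hs : Function.Surjective fun x : F => x - x ^ 2 := hh
        have := Finite.injective_iff_surjective.2 hs (a₁ := 0) (a₂ := 1) (by simp)
        exact zero_ne_one this
      obtain ⟨x, hx⟩ := exists_avoid ({0, 1} : Finset F)
        (lt_of_le_of_lt Finset.card_le_two (by omega))
      obtain ⟨y, hy⟩ := exists_avoid ({0, 1, x, x + 1} : Finset F)
        (lt_of_le_of_lt Finset.card_le_four (by omega))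
      simp only [Finset.mem_insert, Finset.mem_singleton, not_or] at hx hy
      have key : ∀ z w : F, z ^ 2 - 1 * z + (N + (w ^ 2 + w)) ≠ 0 := by
        intro z w h
        apply hN (z + w)
        linear_combination -h + (-z * w + w) * h2
      have hu : x ^ 2 + x ≠ 0 := by
        intro h
        have : x * (x - 1) = 0 := by linear_combination h - x * h2
        rcases mul_eq_zero.1 this with h | h
        · exact hx.1 h
        · exact hx.2 (sub_eq_zero.1 h)
      have hv : y ^ 2 + y ≠ 0 := by
        intro h
        have : y * (y - 1) = 0 := by linear_combination h - y * h2
        rcases mul_eq_zero.1 this with h | h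
        · exact hy.1 h
        · exact hy.2.1 (sub_eq_zero.1 h)
      have huv : x ^ 2 + x ≠ y ^ 2 + y := by
        intro h
        have : (y - x) * (y - (x + 1)) = 0 := by
          linear_combination -h + (x ^ 2 + x - x * y - y) * h2
        rcases mul_eq_zero.1 this with h | h
        · exact hy.2.2.1 (sub_eq_zero.1 h)
        · exact hy.2.2.2 (sub_eq_zero.1 h)
      refine ⟨(1, N), hmem _ _ fun z => by simpa using key z 0,
        (1, N + (x ^ 2 + x)), hmem _ _ fun z => key z x,
        (1, N + (y ^ 2 + y)), hmem _ _ fun z => key z y,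
        (1, N + (x ^ 2 + x) + (y ^ 2 + y)), hmem _ _ fun z h => key z (x + y) ?_,
        ?_, ?_, ?_, ?_, ?_⟩
      · linear_combination h + x * y * h2
      · have hsum : x ^ 2 + x + (y ^ 2 + y) ≠ 0 := by
          intro h
          apply huv
          linear_combination h - (y ^ 2 + y) * h2
        simp only [ne_eq, Prod.mk.injEq, true_and, add_assoc N]
        simp [hu, hv, huv, hsum]
      · simp only; ring
      · simp only; ring
      · simp only; ring
      · simp only; linear_combination (x ^ 2 + x) * (y ^ 2 + y) * h2
    · obtain ⟨w, hw⟩ := exists_avoid ({0, 1} : Finset F)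
        (lt_of_le_of_lt Finset.card_le_two (by omega))
      simp only [Finset.mem_insert, Finset.mem_singleton, not_or] at hw
      have hpow : ∀ x : F, x ^ 4 = x := fun x => by rw [← h4]; exact FiniteField.pow_card x
      have hw2 : w ^ 2 + w + 1 = 0 := by
        have h3 : w * (w - 1) * (w ^ 2 + w + 1) = 0 := by linear_combination hpow w
        exact (mul_eq_zero.1 h3).resolve_left (mul_ne_zero hw.1 (sub_ne_zero.2 hw.2))
      have key : ∀ z : F, z ^ 2 - z + w ≠ 0 := by
        intro z h
        have h5 : w * (w - 1) = 0 := by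
          linear_combination (-(z ^ 2) - z + w - 1 + 2 * z) * h + hpow z + (z ^ 2 - z ^ 3) * h2
        exact (mul_ne_zero hw.1 (sub_ne_zero.2 hw.2)) h5
      have hw3 : w ^ 3 = 1 := by linear_combination (w - 1) * hw2
      have hw21 : w ^ 2 ≠ 1 := by
        intro h
        apply hw.1
        linear_combination hw2 - h - h2
      have hw2w : w ^ 2 ≠ w := by
        intro h
        have : (1 : F) = 0 := by linear_combination hw2 - h - w * h2
        exact one_ne_zero this
      refine ⟨(0, 0), ?_, (1, w), hmem _ _ fun z h => key z (by linear_combination h),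
        (w, 1), hmem _ _ fun z h => key (w ^ 2 * z) ?_,
        (w ^ 2, w ^ 2), hmem _ _ fun z h => key (w * z) ?_, ?_, ?_, ?_, ?_, ?_⟩
      · exact Finset.mem_union_right _ (Finset.mem_image.2 ⟨0, h0, by simp⟩)
      · linear_combination w * h + (w * z ^ 2) * hw3
      · linear_combination w ^ 2 * h + (w * z - w) * hw3
      · simp [hw.2, Ne.symm hw.1, Ne.symm hw.2, hw21.symm, hw2w.symm, Ne.symm (pow_ne_zero 2 hw.1)]
      · simp only; linear_combination hw2 - (w + 1) * h2
      · simp only; linear_combination hw2 - (w + 1) * h2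
      · simp only; linear_combination (w ^ 2 - w + 1) * hw2 - (w ^ 2 + 1) * h2
      · simp only; linear_combination (w ^ 2 - w + 1) * hw2 - (w ^ 2 + 1) * h2
  · have h5 : 4 ≤ Fintype.card F := by omega
    have hchar : ringChar F ≠ 2 := by
      intro h
      apply h2
      have := ringChar.Nat.cast_ringChar (R := F)
      rw [h] at this
      exact_mod_cast this
    obtain ⟨d, hd⟩ := FiniteField.exists_nonsquare hchar
    obtain ⟨e, he⟩ := exists_avoid ({0, 1, -1} : Finset F)
      (lt_of_le_of_lt Finset.card_le_three (by omega))
    simp only [Finset.mem_insert, Finset.mem_singleton, not_or] at he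
    have hd0 : d ≠ 0 := by rintro rfl; exact hd IsSquare.zero
    have h4 : (4 : F) ≠ 0 := by
      have : (4 : F) = 2 * 2 := by norm_num
      rw [this]; exact mul_ne_zero h2 h2
    have key : ∀ s T z : F, T ^ 2 = 1 → s ≠ 0 → z ^ 2 - T * z + (1 - d * s ^ 2) / 4 ≠ 0 := by
      intro s T z hT hs h
      apply hd
      refine ⟨(2 * z - T) / s, ?_⟩
      field_simp at h ⊢
      linear_combination -h - hT
    have hne : (1 - d * 1 ^ 2) / 4 ≠ (1 - d * e ^ 2) / 4 := by
      intro h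
      have h6 : d * ((e - 1) * (e + 1)) = 0 := by
        field_simp at h
        linear_combination h
      rcases mul_eq_zero.1 h6 with h | h
      · exact hd0 h
      rcases mul_eq_zero.1 h with h | h
      · exact he.2.1 (sub_eq_zero.1 h)
      · exact he.2.2 (eq_neg_of_add_eq_zero_left h)
    have h11 : (1 : F) ≠ -1 := by
      intro h
      apply h2
      linear_combination h
    refine ⟨(1, (1 - d * 1 ^ 2) / 4), hmem _ _ fun z => key 1 1 z (by ring) one_ne_zero,
      (1, (1 - d * e ^ 2) / 4), hmem _ _ fun z => key e 1 z (by ring) he.1,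
      (-1, (1 - d * 1 ^ 2) / 4), hmem _ _ fun z => key 1 (-1) z (by ring) one_ne_zero,
      (-1, (1 - d * e ^ 2) / 4), hmem _ _ fun z => key e (-1) z (by ring) he.1, ?_, ?_, ?_, ?_, ?_⟩
    · simp only [ne_eq, Prod.mk.injEq, not_and]
      exact ⟨fun _ => hne, fun h => absurd h h11, fun h => absurd h h11, fun h => absurd h h11,
        fun h => absurd h h11, fun _ => hne⟩
    all_goals (simp only; ring)

end partc
section partd
variable {F : Type*} [Field F] [Fintype F] [DecidableEq F]

lemma weight_count {n : ℕ} (S : Finset F) (pt : Fin n → F × F) (hpt : Function.Injective pt)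
    (him : Finset.univ.image pt = ptSet S) (I : Finset (Σ _ : ℕ, ℕ)) (c : (Σ _ : ℕ, ℕ) → F)
    (v : Fin n → F) (hv : ∀ k, v k = bev I c (pt k).1 (pt k).2) :
    hammingNorm v + (((irrP F).filter fun P => bev I c P.1 P.2 = 0).card +
      (S.filter fun a => bev I c (2 * a) (a ^ 2) = 0).card) = n := by
  have h1 := Finset.card_filter_add_card_filter_not (s := (Finset.univ : Finset (Fin n)))
    (fun k => v k ≠ 0)
  rw [Finset.card_univ, Fintype.card_fin] at h1
  rw [hammingNorm]
  have h2 : (Finset.univ.filter fun k => ¬ v k ≠ 0).card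
      = ((ptSet S).filter fun P => bev I c P.1 P.2 = 0).card := by
    rw [← him, Finset.filter_image, Finset.card_image_of_injective _ hpt]
    congr 1
    ext k
    simp [hv]
  have h3 : ((ptSet S).filter fun P => bev I c P.1 P.2 = 0).card
      = ((irrP F).filter fun P => bev I c P.1 P.2 = 0).card +
      (S.filter fun a => bev I c (2 * a) (a ^ 2) = 0).card := by
    rw [ptSet, Finset.filter_union, Finset.card_union_of_disjoint
      (Finset.disjoint_filter_filter (pt_disj S)), Finset.filter_image,
      Finset.card_image_of_injective _ diag_inj]
  omega

end partd

/-- Suppose either (a) `q ≥ 5`, `0 ≤ t ≤ q`, `4 ≤ m ≤ q−1`, `0 ≤ ℓ ≤ m−1`, or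
(b) `q = 4`, `1 ≤ t ≤ 4` (with `m = 3`, `ℓ = 2`); set `n = t + (q²−q)/2` (which is
`t + 6` in case (b)).  Then there exist `F_q`-linear codes `D ⊆ C` of length `n`
with `dim C − dim D = m(m−1)/2 + ℓ − 4` (which is `1` in case (b)), with
`d(D^⊥) = 4`, and with the minimum distance of `C` at least the designed distance
`δ`.  (By the CSS construction this yields pure asymmetric quantum codes with
parameters `[[n, m(m−1)/2 + ℓ − 4, {d_z ≥ δ, d_x = 4}]]_q` in case (a) and
`[[t+6, 1, {d_z ≥ δ, d_x = 4}]]_4` in case (b).) -/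
theorem statement16 {q t m ℓ : ℕ}
    (hq : ∃ p e : ℕ, p.Prime ∧ 0 < e ∧ q = p ^ e)
    (hcase : (5 ≤ q ∧ t ≤ q ∧ 4 ≤ m ∧ m ≤ q - 1 ∧ ℓ ≤ m - 1) ∨
      (q = 4 ∧ 1 ≤ t ∧ t ≤ 4 ∧ m = 3 ∧ ℓ = 2))
    (F : Type*) [Field F] [Fintype F] [DecidableEq F] (hF : Fintype.card F = q)
    (n : ℕ) (hn : n = t + (q ^ 2 - q) / 2)
    (g : ℤ)
    (hg : g = if Odd q then min (max (2 * ((m : ℤ) - 2)) ((m : ℤ) + ℓ - 1)) (t : ℤ)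
      else if ℓ ≤ m - 2 then max (min ((m : ℤ) - 2) (t : ℤ)) (2 * (t : ℤ) - q)
      else max (min ((m : ℤ) - 1) (t : ℤ)) (2 * (t : ℤ) - q))
    (δ : ℚ)
    (hδ : δ = (n : ℚ) - ((q : ℚ) * ((m : ℚ) - 1) + (ℓ : ℚ) + (g : ℚ)) / 2) :
    ∃ D C : Submodule F (Fin n → F), D ≤ C ∧
      Module.finrank F C = Module.finrank F D + (m * (m - 1) / 2 + ℓ - 4) ∧
      minDist (dualCode D) = 4 ∧
      ∀ v ∈ C, v ≠ 0 → δ ≤ (hammingNorm v : ℚ) := by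
  classical
  subst hF
  set q := Fintype.card F with hqdef
  have hq4 : 4 ≤ q := by omega
  have htq : t ≤ q := by omega
  have hm3 : 3 ≤ m := by omega
  have hmq : m + 1 ≤ q := by omega
  have hl : ℓ ≤ m - 1 := by omega
  -- the rational points
  obtain ⟨S, hS, hS0⟩ : ∃ S : Finset F, S.card = t ∧ (1 ≤ t → (0 : F) ∈ S) := by
    by_cases ht : 1 ≤ t
    · obtain ⟨S, h1, -, h2⟩ := Finset.exists_subsuperset_card_eq
        (Finset.subset_univ ({0} : Finset F)) (n := t) (by simpa using ht)
        (by rw [Finset.card_univ]; exact htq)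
      exact ⟨S, h2, fun _ => h1 (by simp)⟩
    · exact ⟨∅, by simp; omega, fun h => absurd h ht⟩
  have hcard : (ptSet S).card = n := by rw [ptSet_card, hS, hn]
  let e := Finset.equivFinOfCardEq hcard
  let pt : Fin n → F × F := fun k => (e.symm k : F × F)
  have hpt : Function.Injective pt := Subtype.val_injective.comp e.symm.injective
  have him : Finset.univ.image pt = ptSet S := by
    ext P
    simp only [Finset.mem_image, Finset.mem_univ, true_and]
    constructor
    · rintro ⟨k, rfl⟩
      exact (e.symm k).2
    · intro hP
      exact ⟨e ⟨P, hP⟩, by simp [pt]⟩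
  have hdeg : ∀ c : (Σ _ : ℕ, ℕ) → F, (phi (expSet m ℓ) c).natDegree ≤ q * (m - 1) + ℓ := by
    intro c
    apply phi_degree_le
    intro i hi
    rw [mem_expSet (by omega) hl] at hi
    refine ⟨hi.1, ?_⟩
    change q * i.1 + i.2 ≤ _
    rcases hi.2 with h | h
    · have : q * i.1 + q * 1 ≤ q * (m - 1) := by
        rw [← mul_add]; exact Nat.mul_le_mul_left _ (by omega)
      omega
    · have : i.1 = m - 1 := by omega
      rw [this]
      omega
  have hzero : ∀ c : (Σ _ : ℕ, ℕ) → F, phi (expSet m ℓ) c = 0 → ∀ i ∈ expSet m ℓ, c i = 0 := by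
    intro c
    apply phi_ne_zero
    intro i hi
    rw [mem_expSet (by omega) hl] at hi
    refine ⟨hi.1, ?_⟩
    change i.2 < q
    omega
  have hli : LinearIndepOn F (evm pt) (expSet m ℓ : Set (Σ _ : ℕ, ℕ)) := by
    rw [linearIndepOn_finset_iff]
    intro c hc
    apply hzero
    by_contra hne
    have h1 := count_bound_roots (expSet m ℓ) c hne ∅
    have h2 : ((irrP F).filter fun P => bev (expSet m ℓ) c P.1 P.2 = 0) = irrP F := by
      apply Finset.filter_true_of_mem
      intro P hP
      have hP' : P ∈ ptSet S := Finset.mem_union_left _ hP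
      rw [← him] at hP'
      obtain ⟨k, -, rfl⟩ := Finset.mem_image.1 hP'
      rw [← sum_evm, hc]
      rfl
    rw [h2, irrP_card] at h1
    have h3 := hdeg c
    simp only [Finset.filter_empty, Finset.card_empty, add_zero] at h1
    obtain ⟨r, hr⟩ : ∃ r, q = r + 2 := ⟨q - 2, by omega⟩
    have h4 : q * (m - 1) ≤ q * r := Nat.mul_le_mul_left _ (by omega)
    have h5 : q ^ 2 - q = q * (r + 1) := by
      rw [hr, pow_two, ← Nat.mul_sub_one]
      rfl
    have h6 : Even (q * (r + 1)) := by
      have := Nat.even_mul_succ_self (r + 1)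
      rw [hr]
      rwa [mul_comm] at this
    change 2 * ((q ^ 2 - q) / 2) ≤ _ at h1
    rw [h5, Nat.mul_div_cancel' h6.two_dvd, Nat.mul_succ] at h1
    omega
  have hsub : expD ⊆ expSet m ℓ := by
    intro i hi
    rw [mem_expSet (by omega) hl]
    simp only [expD, Finset.mem_insert, Finset.mem_singleton] at hi
    rcases hi with rfl | rfl | rfl | rfl | rfl <;> simp <;> omega
  refine ⟨mcode pt expD, mcode pt (expSet m ℓ), ?_, ?_, ?_, ?_⟩
  · exact Submodule.span_mono (Set.image_mono (Finset.coe_subset.2 hsub))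
  · rw [finrank_mcode hli, finrank_mcode (hli.mono (Finset.coe_subset.2 hsub)),
      expSet_card _ _ (by omega)]
    have : expD.card = 5 := rfl
    rw [this]
    have hmm : 4 ≤ m * (m - 1) / 2 + ℓ := by
      rcases hcase with h | h
      · have : 4 * 3 ≤ m * (m - 1) := Nat.mul_le_mul (by omega) (by omega)
        omega
      · obtain ⟨-, -, -, rfl, rfl⟩ := h
        norm_num
    omega
  · obtain ⟨P1, hP1, P2, hP2, P3, hP3, P4, hP4, ⟨d12, d13, d14, d23, d24, d34⟩, r1, r2, r3, r4⟩ :=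
      four_points S (by
        rcases hcase with h | h
        · exact Or.inl h.1
        · exact Or.inr ⟨h.1, hS0 h.2.1⟩)
    rw [← him] at hP1 hP2 hP3 hP4
    obtain ⟨k1, -, rfl⟩ := Finset.mem_image.1 hP1
    obtain ⟨k2, -, rfl⟩ := Finset.mem_image.1 hP2
    obtain ⟨k3, -, rfl⟩ := Finset.mem_image.1 hP3
    obtain ⟨k4, -, rfl⟩ := Finset.mem_image.1 hP4
    exact minDist_four pt hpt k1 k2 k3 k4 (fun h => d12 (by rw [h])) (fun h => d13 (by rw [h]))
      (fun h => d14 (by rw [h])) (fun h => d23 (by rw [h])) (fun h => d24 (by rw [h]))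
      (fun h => d34 (by rw [h])) r1 r2 r3 r4
  · intro v hv hv0
    obtain ⟨c, hc⟩ := mem_mcode hv
    have hw := weight_count S pt hpt him _ c v hc
    have hne : phi (expSet m ℓ) c ≠ 0 := by
      intro h
      apply hv0
      funext k
      rw [hc k, bev]
      apply Finset.sum_eq_zero
      intro i hi
      rw [hzero c h i hi, map_zero, zero_mul]
    have hd := hdeg c
    have hb : 2 * ((((irrP F).filter fun P => bev (expSet m ℓ) c P.1 P.2 = 0).card : ℤ) +
        (S.filter fun a => bev (expSet m ℓ) c (2 * a) (a ^ 2) = 0).card) ≤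
        (phi (expSet m ℓ) c).natDegree + g := by
      by_cases hodd : Odd q
      · rw [hg, if_pos hodd]
        apply zero_bound_odd hm3 hl _ S hS htq c hne
        intro h2
        have hr : ringChar F = 2 := by
          have h3 : ringChar F ∣ 2 := ringChar.dvd (by exact_mod_cast h2)
          exact ((Nat.dvd_prime Nat.prime_two).1 h3).resolve_left CharP.ringChar_ne_one
        have := FiniteField.even_card_iff_char_two.1 hr
        rw [Nat.odd_iff] at hodd
        omega
      · have h2 : (2 : F) = 0 := by
          have h3 : ringChar F = 2 := by
            rw [FiniteField.even_card_iff_char_two]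
            rw [Nat.odd_iff] at hodd
            omega
          have := ringChar.Nat.cast_ringChar (R := F)
          rw [h3] at this
          exact_mod_cast this
        have h3 := zero_bound_even hm3 hl h2 S hS c hne _ rfl
        rw [hg, if_neg hodd]
        have hm2 : ((m - 2 : ℕ) : ℤ) = (m : ℤ) - 2 := by omega
        have hm1 : ((m - 1 : ℕ) : ℤ) = (m : ℤ) - 1 := by omega
        split_ifs with h4
        · rw [if_pos h4, hm2] at h3
          exact h3
        · rw [if_neg h4, hm1] at h3
          exact h3
    set A := ((irrP F).filter fun P => bev (expSet m ℓ) c P.1 P.2 = 0).card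
    set B := (S.filter fun a => bev (expSet m ℓ) c (2 * a) (a ^ 2) = 0).card
    have hdZ : ((phi (expSet m ℓ) c).natDegree : ℤ) ≤ (q : ℤ) * ((m : ℤ) - 1) + ℓ := by
      have hm1 : ((m - 1 : ℕ) : ℤ) = (m : ℤ) - 1 := by omega
      rw [← hm1]
      exact_mod_cast hd
    have hfin : 2 * ((A : ℤ) + B) ≤ (q : ℤ) * ((m : ℤ) - 1) + ℓ + g := by linarith
    have hfinQ : 2 * ((A : ℚ) + B) ≤ (q : ℚ) * ((m : ℚ) - 1) + ℓ + g := by exact_mod_cast hfin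
    have hwQ : (hammingNorm v : ℚ) + (A + B) = n := by exact_mod_cast hw
    rw [hδ]
    linarith
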